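/- The conjugate function of F1, defined for s ≥ 0 by F̃1(s) = sup over t ≥ 0 of (s·t − F1(t)), satisfies the Δ₂-condition: there exists a constant k > 0 such that F̃1(2s) ≤ k·F̃1(s) for every s ≥ 0. -/

import Mathlib

open Real Filter

/-- The convex part `F₁` of the decomposition of `(1/2) s² log s²`. -/
noncomputable def F1 (δ : ℝ) : ℝ → ℝ := fun s =>
  if |s| < δ then -(1/2) * s^2 * Real.log (s^2)
  else -(1/2) * s^2 * (Real.log (δ^2) + 3) + 2*δ*|s| - δ^2/2

/-- The subcritical part `F₂` of the decomposition of `(1/2) s² log s²`. -/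
noncomputable def F2 (δ : ℝ) : ℝ → ℝ := fun s =>
  if |s| < δ then 0
  else (1/2) * s^2 * Real.log (s^2/δ^2) + 2*δ*|s| - (3/2)*s^2 - δ^2/2

/-- The derivative of `F1`. -/
noncomputable def F1' (δ : ℝ) : ℝ → ℝ := fun s =>
  if |s| < δ then -(Real.log (s^2) + 1) * s
  else -(Real.log (δ^2) + 3) * s + 2*δ*Real.sign s

/-- The derivative of `F2`. -/
noncomputable def F2' (δ : ℝ) : ℝ → ℝ := fun s =>
  if |s| ≤ δ then 0
  else s * Real.log (s^2/δ^2) + 2*δ*Real.sign s - 2*s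

/-- The conjugate (Legendre transform) of `F1`, for `s ≥ 0`. -/
noncomputable def F1conj (δ : ℝ) (s : ℝ) : ℝ :=
  ⨆ t : Set.Ici (0:ℝ), (s * (t:ℝ) - F1 δ t)

theorem F1_of_lt {δ t : ℝ} (ht : 0 ≤ t) (h : t < δ) : F1 δ t = t ^ 2 * -Real.log t := by
  rw [F1, if_pos (by rwa [abs_of_nonneg ht]), Real.log_pow]
  push_cast
  ring

theorem F1_of_le {δ t : ℝ} (ht : 0 ≤ t) (h : δ ≤ t) :
    F1 δ t = (2 * -Real.log δ - 3) / 2 * t ^ 2 + 2 * δ * t - δ ^ 2 / 2 := by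
  rw [F1, if_neg (by rwa [abs_of_nonneg ht, not_lt]), Real.log_pow, abs_of_nonneg ht]
  push_cast
  ring

theorem neg_log_gt_of_lt_exp {δ : ℝ} (hδ0 : 0 < δ) (hδ : δ < Real.exp (-(3/2))) :
    3 / 2 < -Real.log δ := by
  have := (Real.log_lt_iff_lt_exp hδ0).2 hδ
  linarith

theorem le_F1_of_le {δ t : ℝ} (hδ0 : 0 < δ) (h : δ ≤ t) :
    (2 * -Real.log δ - 3) / 2 * t ^ 2 ≤ F1 δ t := by
  rw [F1_of_le (hδ0.le.trans h) h]
  nlinarith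

theorem bddAbove_F1conj {δ : ℝ} (hδ0 : 0 < δ) (hδ : δ < Real.exp (-(3/2)))
    {s : ℝ} (hs : 0 ≤ s) :
    BddAbove (Set.range fun t : Set.Ici (0:ℝ) => s * (t:ℝ) - F1 δ t) := by
  have hL := neg_log_gt_of_lt_exp hδ0 hδ
  set A := 2 * -Real.log δ - 3 with hA
  have hA0 : 0 < A := by linarith
  refine ⟨s * δ + s ^ 2 / (2 * A), ?_⟩
  rintro _ ⟨⟨t, ht⟩, rfl⟩
  have ht : 0 ≤ t := ht
  have h2 : 0 ≤ s ^ 2 / (2 * A) := by positivity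
  have h1 : 0 ≤ s * δ := by positivity
  rcases lt_or_ge t δ with h | h
  · have hF : 0 ≤ F1 δ t := by
      rw [F1_of_lt ht h]
      rcases ht.eq_or_lt with rfl | h0
      · simp
      · have := Real.log_lt_log h0 h
        exact mul_nonneg (sq_nonneg t) (by linarith)
    have := mul_le_mul_of_nonneg_left h.le hs
    dsimp only
    linarith
  · have hF : A / 2 * t ^ 2 ≤ F1 δ t := le_F1_of_le hδ0 h
    have key : s * t - A / 2 * t ^ 2 ≤ s ^ 2 / (2 * A) := by
      rw [le_div_iff₀ (by positivity)]
      nlinarith [sq_nonneg (s - A * t)]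
    dsimp only
    linarith

/-- The `∇₂`-condition for `F1`, dual to the `Δ₂`-condition for its conjugate. -/
theorem exists_F1_mul_le {δ : ℝ} (hδ0 : 0 < δ) (hδ : δ < Real.exp (-(3/2))) :
    ∃ c : ℝ, 0 < c ∧ ∀ t : ℝ, 0 ≤ t → F1 δ (c * t) ≤ c / 2 * F1 δ t := by
  have hL := neg_log_gt_of_lt_exp hδ0 hδ
  set L := -Real.log δ with hLdef
  set e := (2 * L - 3) / (4 * (L + 2)) with he
  have he0 : 0 < e := div_pos (by linarith) (by linarith)
  have he1 : e < 1 := by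
    rw [he, div_lt_one (by linarith)]
    linarith
  have heL : e * (L + 2) = (2 * L - 3) / 4 := by
    rw [he]
    field_simp
  have hc1 : e ^ 2 ≤ e := by nlinarith
  have hclog : e ^ 2 * -Real.log (e ^ 2) ≤ 2 * e := by
    have h := Real.one_sub_inv_le_log_of_pos he0
    rw [Real.log_pow]
    push_cast
    have h1 : -Real.log e ≤ e⁻¹ := by linarith
    have h2 := mul_le_mul_of_nonneg_left h1 (sq_nonneg e)
    have h3 : e ^ 2 * e⁻¹ = e := by field_simp
    linarith
  have hcL : e ^ 2 * L ≤ e * L := mul_le_mul_of_nonneg_right hc1 (by linarith)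
  have hsum : e ^ 2 * L + e ^ 2 * -Real.log (e ^ 2) ≤ (2 * L - 3) / 4 := by linarith
  have hc0 : 0 < e ^ 2 := by positivity
  generalize e ^ 2 = c at *
  have hcLe : c * (L + 2) ≤ (2 * L - 3) / 4 := by
    rw [← heL]
    exact mul_le_mul_of_nonneg_right hc1 (by linarith)
  refine ⟨c, hc0, fun t ht => ?_⟩
  rcases ht.eq_or_lt with rfl | h0
  · rw [mul_zero, F1_of_lt le_rfl hδ0]
    simp
  have hct : 0 < c * t := by positivity
  have hlog : Real.log (c * t) = Real.log c + Real.log t :=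
    Real.log_mul hc0.ne' h0.ne'
  rcases lt_or_ge t δ with h | h
  · have hctδ : c * t < δ := by nlinarith
    rw [F1_of_lt hct.le hctδ, F1_of_lt ht h, hlog]
    have hlt := Real.log_lt_log h0 h
    have hb : c * (-Real.log c + -Real.log t) ≤ -Real.log t / 2 := by
      have hc2 : c ≤ 1 / 2 := by nlinarith
      nlinarith
    have := mul_le_mul_of_nonneg_left hb (by positivity : 0 ≤ c * t ^ 2)
    linarith
  · have hF : (2 * L - 3) / 2 * t ^ 2 ≤ F1 δ t := le_F1_of_le hδ0 h
    have hF' := mul_le_mul_of_nonneg_left hF (by positivity : 0 ≤ c / 2)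
    refine le_trans ?_ hF'
    rcases lt_or_ge (c * t) δ with h' | h'
    · rw [F1_of_lt hct.le h', hlog]
      have hle := Real.log_le_log hδ0 h
      have hb : c * (-Real.log c + -Real.log t) ≤ (2 * L - 3) / 4 := by nlinarith
      have := mul_le_mul_of_nonneg_left hb (by positivity : 0 ≤ c * t ^ 2)
      linarith
    · rw [F1_of_le hct.le h', ← hLdef]
      have h1 := mul_le_mul_of_nonneg_right h' hct.le
      have h2 := mul_le_mul_of_nonneg_left hcLe (by positivity : 0 ≤ c * t ^ 2)
      nlinarith [sq_nonneg δ, sq_nonneg (c * t)]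

/-- The conjugate function `F̃1` satisfies the `Δ₂`-condition. -/
theorem F1conj_delta2 (δ : ℝ) (hδ0 : 0 < δ) (hδ : δ < Real.exp (-(3/2))) :
    ∃ k : ℝ, 0 < k ∧ ∀ s : ℝ, 0 ≤ s → F1conj δ (2*s) ≤ k * F1conj δ s := by
  obtain ⟨c, hc0, hc⟩ := exists_F1_mul_le hδ0 hδ
  have hk : 0 < 2 / c := by positivity
  refine ⟨2 / c, hk, fun s hs => ?_⟩
  have : Nonempty (Set.Ici (0:ℝ)) := ⟨⟨0, Set.mem_Ici.2 le_rfl⟩⟩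
  refine ciSup_le ?_
  rintro ⟨t, ht⟩
  have hle : s * (c * t) - F1 δ (c * t) ≤ F1conj δ s :=
    le_ciSup (bddAbove_F1conj hδ0 hδ hs) ⟨c * t, mul_nonneg hc0.le ht⟩
  refine le_trans ?_ (mul_le_mul_of_nonneg_left hle hk.le)
  have h := mul_le_mul_of_nonneg_left (hc t ht) hk.le
  have h1 : 2 / c * (c / 2 * F1 δ t) = F1 δ t := by field_simp
  have h2 : 2 / c * (s * (c * t)) = 2 * s * t := by field_simp
  rw [mul_sub, h2]
  dsimp only
  linarith
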